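/- Define F : (0, ∞) → ℝ by F(s) = ∫_0^{π} cos(t) / √(2 (1 − cos t) + s) dt. Then there exist δ > 0 and functions f₁, f₂ : ℝ → ℝ that are infinitely differentiable on the interval (−δ, δ) with f₁(0) = 0 and f₂(0) = 0, such that for all s ∈ (0, δ): F(s) = log(8 / √s) − 2 + f₁(s) + f₂(s) · log(s). -/

import Mathlib

open Real

/-- The kernel function `F(s) = ∫_0^π cos t / √(2(1−cos t)+s) dt`. -/
noncomputable def ringKernelF (s : ℝ) : ℝ :=
  ∫ t in (0:ℝ)..π, Real.cos t / Real.sqrt (2 * (1 - Real.cos t) + s)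


lemma param_deriv (U : Set ℝ) (hU : IsOpen U) (G G' : ℝ → ℝ → ℝ) (a b : ℝ)
    (hG : ∀ x ∈ U, Continuous (G x))
    (hG' : ContinuousOn (Function.uncurry G') (U ×ˢ Set.univ))
    (hd : ∀ x ∈ U, ∀ t, HasDerivAt (fun y => G y t) (G' x t) x) (x : ℝ) (hx : x ∈ U) :
    HasDerivAt (fun y => ∫ t in a..b, G y t) (∫ t in a..b, G' x t) x := by
  obtain ⟨r, hr, hrU⟩ := Metric.nhds_basis_closedBall.mem_iff.1 (hU.mem_nhds hx)
  have hcomp : IsCompact (Metric.closedBall x r ×ˢ Set.uIcc a b) :=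
    (isCompact_closedBall x r).prod isCompact_uIcc
  obtain ⟨C, hC⟩ := hcomp.exists_bound_of_continuousOn
    (hG'.mono (Set.prod_mono hrU (Set.subset_univ _)))
  have hcont : ∀ y ∈ U, Continuous (G' y) := by
    intro y hy
    have : Continuous (Function.uncurry G' ∘ fun t => (y, t)) := by
      apply hG'.comp_continuous (by fun_prop)
      intro t; exact ⟨hy, trivial⟩
    exact this
  refine (intervalIntegral.hasDerivAt_integral_of_dominated_loc_of_deriv_le
    (F := G) (F' := G') (bound := fun _ => C) (s := Metric.closedBall x r)
    (Metric.closedBall_mem_nhds x hr) ?_ ((hG x hx).intervalIntegrable _ _)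
    (hcont x hx).aestronglyMeasurable ?_ (by simp) ?_).2
  · filter_upwards [hU.mem_nhds hx] with y hy
    exact (hG y hy).aestronglyMeasurable
  · refine Filter.Eventually.of_forall fun t ht y hy => ?_
    exact hC (y, t) ⟨hy, Set.uIoc_subset_uIcc ht⟩
  · exact Filter.Eventually.of_forall fun t _ y hy => hd y (hrU hy) t

lemma param_smooth_aux (U : Set ℝ) (hU : IsOpen U) (a b : ℝ) (n : ℕ) : ∀ (G : ℝ → ℝ → ℝ)
    (_ : ContDiffOn ℝ (⊤ : ℕ∞) (Function.uncurry G) (U ×ˢ Set.univ)),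
    ContDiffOn ℝ n (fun y => ∫ t in a..b, G y t) U := by
  have hUo : IsOpen (U ×ˢ (Set.univ : Set ℝ)) := hU.prod isOpen_univ
  have key : ∀ (G : ℝ → ℝ → ℝ)
    (_ : ContDiffOn ℝ (⊤ : ℕ∞) (Function.uncurry G) (U ×ˢ Set.univ)),
    ∃ G' : ℝ → ℝ → ℝ, ContDiffOn ℝ (⊤ : ℕ∞) (Function.uncurry G') (U ×ˢ Set.univ) ∧
      ∀ x ∈ U, HasDerivAt (fun y => ∫ t in a..b, G y t) (∫ t in a..b, G' x t) x := by
    intro G hG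
    have h1 := ((contDiffOn_infty_iff_fderiv_of_isOpen hUo).1 hG)
    have hsm : ContDiffOn ℝ (⊤ : ℕ∞)
      (Function.uncurry fun x t => fderiv ℝ (Function.uncurry G) (x, t) (1, 0)) (U ×ˢ Set.univ) :=
      h1.2.clm_apply contDiffOn_const
    refine ⟨_, hsm, param_deriv U hU G _ a b ?_ hsm.continuousOn ?_⟩
    · intro y hy
      have : Continuous (Function.uncurry G ∘ fun t => (y, t)) := by
        apply hG.continuousOn.comp_continuous (by fun_prop)
        intro t; exact ⟨hy, trivial⟩
      exact this
    · intro x hx t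
      have h2 : HasFDerivAt (Function.uncurry G) (fderiv ℝ (Function.uncurry G) (x, t)) (x, t) :=
        (h1.1.differentiableAt (hUo.mem_nhds ⟨hx, trivial⟩)).hasFDerivAt
      have h3 : HasDerivAt (fun y : ℝ => (y, t)) ((1 : ℝ), (0 : ℝ)) x :=
        (hasDerivAt_id x).prodMk (hasDerivAt_const x t)
      exact h2.comp_hasDerivAt x h3
  induction n with
  | zero =>
    intro G hG
    obtain ⟨G', -, hG'⟩ := key G hG
    simp only [Nat.cast_zero, contDiffOn_zero]
    exact fun x hx => (hG' x hx).continuousAt.continuousWithinAt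
  | succ n ih =>
    intro G hG
    obtain ⟨G', hs, hG'⟩ := key G hG
    push_cast
    rw [contDiffOn_succ_iff_deriv_of_isOpen hU]
    refine ⟨fun x hx => (hG' x hx).differentiableAt.differentiableWithinAt, by simp, ?_⟩
    exact (ih G' hs).congr fun x hx => (hG' x hx).deriv

lemma param_smooth (U : Set ℝ) (hU : IsOpen U) (a b : ℝ) (G : ℝ → ℝ → ℝ)
    (hG : ContDiffOn ℝ (⊤ : ℕ∞) (Function.uncurry G) (U ×ˢ Set.univ)) :
    ContDiffOn ℝ (⊤ : ℕ∞) (fun y => ∫ t in a..b, G y t) U :=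
  contDiffOn_infty.2 fun n => param_smooth_aux U hU a b n G hG

/-- `P`, `Q` -/
noncomputable def PP (e : ℝ) : ℝ := ∫ u in (0:ℝ)..(π/2), 1 / √(e + sin u ^ 2)
noncomputable def QQ (e : ℝ) : ℝ := ∫ u in (0:ℝ)..(π/2), √(e + sin u ^ 2)
noncomputable def pp (e : ℝ) : ℝ := ∫ u in (0:ℝ)..(π/2), 1 / √(1 + e * sin u ^ 2)
noncomputable def qq (e : ℝ) : ℝ := ∫ u in (0:ℝ)..(π/2), √(1 + e * sin u ^ 2)
noncomputable def mm (e : ℝ) : ℝ :=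
  ∫ u in (0:ℝ)..(π/2), sin u ^ 2 / (√(1 + e * sin u ^ 2) * (1 + √(1 + e * sin u ^ 2)))

lemma pos1 (e : ℝ) (he : e ∈ Set.Ioo (-1:ℝ) 1) (u : ℝ) : 0 < 1 + e * sin u ^ 2 := by
  have := sin_sq_le_one u
  have := sq_nonneg (sin u)
  nlinarith [he.1, he.2]

lemma pos2 (e : ℝ) (he : 0 < e) (u : ℝ) : 0 < e + sin u ^ 2 := by positivity

lemma sm_base : ContDiffOn ℝ (⊤ : ℕ∞) (fun z : ℝ × ℝ => √(1 + z.1 * sin z.2 ^ 2))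
    (Set.Ioo (-1:ℝ) 1 ×ˢ Set.univ) := by
  apply ContDiffOn.sqrt
  · fun_prop
  · rintro ⟨e, u⟩ ⟨he, -⟩; exact (pos1 e he u).ne'

lemma pp_smooth : ContDiffOn ℝ (⊤ : ℕ∞) pp (Set.Ioo (-1) 1) := by
  apply param_smooth _ isOpen_Ioo
  apply ContDiffOn.div contDiffOn_const sm_base
  rintro ⟨e, u⟩ ⟨he, -⟩; exact (sqrt_pos.2 (pos1 e he u)).ne'

lemma qq_smooth : ContDiffOn ℝ (⊤ : ℕ∞) qq (Set.Ioo (-1) 1) := by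
  apply param_smooth _ isOpen_Ioo
  exact sm_base

lemma mm_smooth : ContDiffOn ℝ (⊤ : ℕ∞) mm (Set.Ioo (-1) 1) := by
  apply param_smooth _ isOpen_Ioo
  apply ContDiffOn.div (by fun_prop) (sm_base.mul (contDiffOn_const.add sm_base))
  rintro ⟨e, u⟩ ⟨he, -⟩
  have := (sqrt_pos.2 (pos1 e he u))
  show √(1 + e * sin u ^ 2) * (1 + √(1 + e * sin u ^ 2)) ≠ 0
  positivity

lemma int_identity (a c : ℝ) (h : ∀ u, 0 < a + c * sin u ^ 2) :
    ∫ u in (0:ℝ)..(π/2), √(a + c * sin u ^ 2)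
      = a * (a + c) * ∫ u in (0:ℝ)..(π/2), 1 / √(a + c * sin u ^ 2) ^ 3 := by
  have hc : Continuous fun u => √(a + c * sin u ^ 2) := by fun_prop
  have hne : ∀ u, √(a + c * sin u ^ 2) ≠ 0 := fun u => (sqrt_pos.2 (h u)).ne'
  have hc3 : Continuous fun u => 1 / √(a + c * sin u ^ 2) ^ 3 :=
    continuous_const.div (hc.pow 3) fun u => pow_ne_zero 3 (hne u)
  rw [← sub_eq_zero, ← intervalIntegral.integral_const_mul,
    ← intervalIntegral.integral_sub (hc.intervalIntegrable _ _)
      ((hc3.const_mul _).intervalIntegrable _ _)]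
  have hd : ∀ u, HasDerivAt (fun u => -c * (sin u * cos u / √(a + c * sin u ^ 2)))
      (√(a + c * sin u ^ 2) - a * (a + c) * (1 / √(a + c * sin u ^ 2) ^ 3)) u := by
    intro u
    have h1 : HasDerivAt (fun u => a + c * sin u ^ 2) (c * (2 * sin u * cos u)) u := by
      have := (((hasDerivAt_sin u).pow 2).const_mul c).const_add a
      refine this.congr_deriv ?_
      push_cast
      ring
    have h2 := h1.sqrt (h u).ne'
    have h3 := (((hasDerivAt_sin u).mul (hasDerivAt_cos u)).div h2 (hne u)).const_mul (-c)
    refine h3.congr_deriv ?_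
    have hs := sq_sqrt (h u).le
    have hcs := cos_sq' u
    have hn := hne u
    simp only [Pi.mul_apply]
    set w := √(a + c * sin u ^ 2)
    have : w * w⁻¹ = 1 := mul_inv_cancel₀ hn
    have hs4 : w ^ 4 = (a + c * sin u ^ 2) ^ 2 := by rw [← hs]; ring
    field_simp
    rw [hs4, hs]
    have : cos u * cos u = 1 - sin u ^ 2 := by rw [← hcs]; ring
    simp only [hcs]
    ring
  rw [intervalIntegral.integral_eq_sub_of_hasDerivAt (fun u _ => hd u)
    ((hc.sub (hc3.const_mul _)).intervalIntegrable _ _)]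
  simp

lemma sqrt_inv_deriv (f : ℝ → ℝ) (f' x : ℝ) (hf : HasDerivAt f f' x) (h : 0 < f x) :
    HasDerivAt (fun y => 1 / √(f y)) (-(f' / 2) * (1 / √(f x) ^ 3)) x := by
  have h2 := (hf.sqrt h.ne').inv (sqrt_pos.2 h).ne'
  have hp := sqrt_pos.2 h
  simp only [one_div]
  refine h2.congr_deriv ?_
  field_simp

lemma QQ_deriv (e : ℝ) (he : 0 < e) : HasDerivAt QQ (PP e / 2) e := by
  have := param_deriv (Set.Ioi 0) isOpen_Ioi (fun e u => √(e + sin u ^ 2))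
    (fun e u => 1 / (2 * √(e + sin u ^ 2))) 0 (π/2) (by intro x _; fun_prop) ?_ ?_ e he
  · refine this.congr_deriv ?_
    rw [PP, ← intervalIntegral.integral_div]
    congr 1; ext u
    rw [div_div, mul_comm]
  · apply ContinuousOn.div (by fun_prop) (by fun_prop)
    rintro ⟨x, u⟩ ⟨hx, -⟩
    have := sqrt_pos.2 (pos2 x hx u)
    simp only []
    positivity
  · intro x hx u
    exact ((hasDerivAt_id x).add_const (sin u ^ 2)).sqrt (pos2 x hx u).ne'

lemma PP_deriv (e : ℝ) (he : 0 < e) : HasDerivAt PP (-QQ e / (2 * e * (1 + e))) e := by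
  have := param_deriv (Set.Ioi 0) isOpen_Ioi (fun e u => 1 / √(e + sin u ^ 2))
    (fun e u => -(1 / 2) * (1 / √(e + sin u ^ 2) ^ 3)) 0 (π/2) ?_ ?_ ?_ e he
  · refine this.congr_deriv ?_
    have h1 := int_identity e 1 (by intro u; rw [one_mul]; exact pos2 e he u)
    simp only [one_mul] at h1
    rw [intervalIntegral.integral_const_mul, QQ, h1]
    field_simp
    ring
  · intro x hx
    exact continuous_const.div (by fun_prop) fun u => (sqrt_pos.2 (pos2 x hx u)).ne'
  · apply ContinuousOn.mul (by fun_prop)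
    apply ContinuousOn.div (by fun_prop) (by fun_prop)
    rintro ⟨x, u⟩ ⟨hx, -⟩
    exact pow_ne_zero 3 (sqrt_pos.2 (pos2 x hx u)).ne'
  · intro x hx u
    exact sqrt_inv_deriv (fun y => y + sin u ^ 2) 1 x ((hasDerivAt_id x).add_const (sin u ^ 2))
      (pos2 x hx u)

lemma cont1 (e : ℝ) (he : e ∈ Set.Ioo (-1:ℝ) 1) :
    Continuous fun u => 1 / √(1 + e * sin u ^ 2) :=
  continuous_const.div (by fun_prop) fun u => (sqrt_pos.2 (pos1 e he u)).ne'

lemma cont3 (e : ℝ) (he : e ∈ Set.Ioo (-1:ℝ) 1) :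
    Continuous fun u => 1 / √(1 + e * sin u ^ 2) ^ 3 :=
  continuous_const.div (by fun_prop) fun u => pow_ne_zero 3 (sqrt_pos.2 (pos1 e he u)).ne'

lemma base_deriv (x u : ℝ) : HasDerivAt (fun y => 1 + y * sin u ^ 2) (sin u ^ 2) x := by
  have := ((hasDerivAt_id x).mul_const (sin u ^ 2)).const_add 1
  exact this.congr_deriv (by ring)

lemma qq_deriv (e : ℝ) (he : e ∈ Set.Ioo (-1:ℝ) 1) (h0 : e ≠ 0) :
    HasDerivAt qq ((qq e - pp e) / (2 * e)) e := by
  have := param_deriv (Set.Ioo (-1) 1) isOpen_Ioo (fun e u => √(1 + e * sin u ^ 2))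
    (fun e u => sin u ^ 2 / (2 * √(1 + e * sin u ^ 2))) 0 (π/2) (by intro x _; fun_prop) ?_ ?_ e he
  · refine this.congr_deriv ?_
    rw [qq, pp, ← intervalIntegral.integral_sub, ← intervalIntegral.integral_div]
    · congr 1; ext u
      have h1 := sqrt_pos.2 (pos1 e he u)
      have h2 := sq_sqrt (pos1 e he u).le
      set w := √(1 + e * sin u ^ 2)
      have h3 : e * sin u ^ 2 = w ^ 2 - 1 := by rw [h2]; ring
      have h4 : sin u ^ 2 = (w ^ 2 - 1) / e := by rw [← h3]; field_simp
      clear_value w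
      rw [h4]
      field_simp
    · apply Continuous.intervalIntegrable; fun_prop
    · exact (cont1 e he).intervalIntegrable _ _
  · apply ContinuousOn.div (by fun_prop) (by fun_prop)
    rintro ⟨x, u⟩ ⟨hx, -⟩
    have := sqrt_pos.2 (pos1 x hx u)
    simp only []
    positivity
  · intro x hx u
    exact (base_deriv x u).sqrt (pos1 x hx u).ne'

lemma pp_deriv (e : ℝ) (he : e ∈ Set.Ioo (-1:ℝ) 1) (h0 : e ≠ 0) :
    HasDerivAt pp ((qq e / (1 + e) - pp e) / (2 * e)) e := by
  have := param_deriv (Set.Ioo (-1) 1) isOpen_Ioo (fun e u => 1 / √(1 + e * sin u ^ 2))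
    (fun e u => -(sin u ^ 2 / 2) * (1 / √(1 + e * sin u ^ 2) ^ 3)) 0 (π/2) cont1 ?_ ?_ e he
  · refine this.congr_deriv ?_
    have h1 := int_identity 1 e (pos1 e he)
    have h1e : 1 + e ≠ 0 := by linarith [he.1]
    have h2 : qq e / (1 + e) = ∫ u in (0:ℝ)..(π/2), 1 / √(1 + e * sin u ^ 2) ^ 3 := by
      rw [qq, h1]; field_simp
    rw [h2, pp, ← intervalIntegral.integral_sub, ← intervalIntegral.integral_div]
    · congr 1; ext u
      have h1 := sqrt_pos.2 (pos1 e he u)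
      have h2 := sq_sqrt (pos1 e he u).le
      set w := √(1 + e * sin u ^ 2)
      have h3 : e * sin u ^ 2 = w ^ 2 - 1 := by rw [h2]; ring
      have h4 : sin u ^ 2 = (w ^ 2 - 1) / e := by rw [← h3]; field_simp
      clear_value w
      rw [h4]
      field_simp
      ring
    · exact (cont3 e he).intervalIntegrable _ _
    · exact (cont1 e he).intervalIntegrable _ _
  · apply ContinuousOn.mul (by fun_prop)
    apply ContinuousOn.div (by fun_prop) (by fun_prop)
    rintro ⟨x, u⟩ ⟨hx, -⟩
    exact pow_ne_zero 3 (sqrt_pos.2 (pos1 x hx u)).ne'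
  · intro x hx u
    exact sqrt_inv_deriv (fun y => 1 + y * sin u ^ 2) _ x (base_deriv x u) (pos1 x hx u)

noncomputable def bb (e : ℝ) : ℝ := (1 + e) * pp e - qq e

lemma bb_smooth : ContDiffOn ℝ (⊤ : ℕ∞) bb (Set.Ioo (-1) 1) :=
  ((contDiffOn_const.add contDiffOn_id).mul pp_smooth).sub qq_smooth

lemma bb_deriv (e : ℝ) (he : e ∈ Set.Ioo (-1:ℝ) 1) (h0 : e ≠ 0) :
    HasDerivAt bb (pp e / 2) e := by
  have := (((hasDerivAt_id e).const_add 1).mul (pp_deriv e he h0)).sub (qq_deriv e he h0)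
  refine this.congr_deriv ?_
  have h1e : 1 + e ≠ 0 := by linarith [he.1]
  simp only [id]
  field_simp
  ring

lemma pp_deriv' (e : ℝ) (he : e ∈ Set.Ioo (-1:ℝ) 1) (h0 : e ≠ 0) :
    HasDerivAt pp (- bb e / (2 * e * (1 + e))) e := by
  refine (pp_deriv e he h0).congr_deriv ?_
  have h1e : 1 + e ≠ 0 := by linarith [he.1]
  rw [bb]
  field_simp
  ring

lemma pp_pos (e : ℝ) (he : e ∈ Set.Ioo (-1:ℝ) 1) : 0 < pp e := by
  apply intervalIntegral.intervalIntegral_pos_of_pos ((cont1 e he).intervalIntegrable _ _)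
  · intro u; have := sqrt_pos.2 (pos1 e he u); positivity
  · positivity

lemma pp_zero : pp 0 = π / 2 := by simp [pp]
lemma qq_zero : qq 0 = π / 2 := by simp [qq]
lemma bb_zero : bb 0 = 0 := by simp [bb, pp_zero, qq_zero]

lemma mm_eq (e : ℝ) (he : e ∈ Set.Ioo (-1:ℝ) 1) : π / 2 - pp e = e * mm e := by
  rw [← pp_zero, pp, pp, mm, ← intervalIntegral.integral_const_mul,
    ← intervalIntegral.integral_sub]
  · congr 1; ext u
    have h1 := sqrt_pos.2 (pos1 e he u)
    have h2 := sq_sqrt (pos1 e he u).le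
    have : e * sin u ^ 2 = √(1 + e * sin u ^ 2) ^ 2 - 1 := by rw [h2]; ring
    simp only [zero_mul, add_zero, sqrt_one]
    rw [← mul_div_assoc, this, ← this]
    set w := √(1 + e * sin u ^ 2)
    rw [this]
    field_simp
    ring
  · exact (cont1 0 (by norm_num)).intervalIntegrable _ _
  · exact (cont1 e he).intervalIntegrable _ _

lemma bb_eq (e : ℝ) (he : e ∈ Set.Ioo (-1:ℝ) 1) :
    bb e = e * ∫ u in (0:ℝ)..(π/2), cos u ^ 2 / √(1 + e * sin u ^ 2) := by
  rw [bb, pp, qq, ← intervalIntegral.integral_const_mul, ← intervalIntegral.integral_const_mul,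
    ← intervalIntegral.integral_sub]
  · congr 1; ext u
    have h1 := sqrt_pos.2 (pos1 e he u)
    have h2 := sq_sqrt (pos1 e he u).le
    field_simp
    rw [h2, cos_sq']; ring
  · exact ((cont1 e he).const_mul _).intervalIntegrable _ _
  · apply Continuous.intervalIntegrable; fun_prop

open Filter Topology

lemma const_lim (f : ℝ → ℝ) (c : ℝ) (hd : ∀ e ∈ Set.Ioo (0:ℝ) 1, HasDerivAt f 0 e)
    (hl : Tendsto f (𝓝[>] 0) (𝓝 c)) (e : ℝ) (he : e ∈ Set.Ioo (0:ℝ) 1) : f e = c := by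
  have h1 : ∀ y ∈ Set.Ioo (0:ℝ) 1, f y = f e := fun y hy =>
    isOpen_Ioo.is_const_of_deriv_eq_zero isPreconnected_Ioo
      (fun x hx => (hd x hx).differentiableAt.differentiableWithinAt)
      (fun x hx => (hd x hx).deriv) hy he
  have h2 : Tendsto f (𝓝[>] 0) (𝓝 (f e)) := by
    refine tendsto_const_nhds.congr' ?_
    filter_upwards [Ioo_mem_nhdsGT (zero_lt_one' ℝ)] with y hy
    exact (h1 y hy).symm
  exact tendsto_nhds_unique h2 hl

lemma lim_of_smooth (f : ℝ → ℝ) (hf : ContDiffOn ℝ (⊤ : ℕ∞) f (Set.Ioo (-1) 1)) :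
    Tendsto f (𝓝[>] 0) (𝓝 (f 0)) :=
  (hf.continuousOn.continuousAt (Ioo_mem_nhds (by norm_num) (by norm_num))).tendsto.mono_left
    nhdsWithin_le_nhds

lemma elog : Tendsto (fun e : ℝ => e * log e) (𝓝[>] 0) (𝓝 0) := by
  have := (Real.continuous_mul_log.tendsto 0).mono_left (nhdsWithin_le_nhds (s := Set.Ioi (0:ℝ)))
  simpa using this

lemma QQ_lim : Tendsto QQ (𝓝[>] 0) (𝓝 1) := by
  have h : Continuous QQ := by
    apply intervalIntegral.continuous_parametric_intervalIntegral_of_continuous'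
    unfold Function.uncurry
    fun_prop
  have h0 : QQ 0 = 1 := by
    have : QQ 0 = ∫ u in (0:ℝ)..(π/2), sin u := by
      apply intervalIntegral.integral_congr
      intro u hu
      rw [Set.uIcc_of_le (by positivity)] at hu
      simp only [zero_add]
      exact sqrt_sq (sin_nonneg_of_nonneg_of_le_pi hu.1 (by linarith [hu.2, pi_pos]))
    rw [this]; simp
  have := (h.tendsto 0).mono_left (nhdsWithin_le_nhds (s := Set.Ioi (0:ℝ)))
  rwa [h0] at this

lemma cos_int (e : ℝ) (he : 0 < e) : ∫ u in (0:ℝ)..(π/2), cos u / √(e + sin u ^ 2)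
    = log (1 + √(e + 1)) - log e / 2 := by
  have hpos : ∀ u, 0 < sin u + √(e + sin u ^ 2) := by
    intro u
    have : |sin u| < √(e + sin u ^ 2) := by
      apply lt_sqrt_of_sq_lt; rw [sq_abs]; linarith
    linarith [neg_abs_le (sin u)]
  have hd : ∀ u, HasDerivAt (fun u => log (sin u + √(e + sin u ^ 2)))
      (cos u / √(e + sin u ^ 2)) u := by
    intro u
    have h0 := sqrt_pos.2 (pos2 e he u)
    have h1 : HasDerivAt (fun u => e + sin u ^ 2) (2 * sin u * cos u) u := by
      have := ((hasDerivAt_sin u).pow 2).const_add e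
      refine this.congr_deriv ?_
      push_cast
      ring
    have h2 := ((hasDerivAt_sin u).add (h1.sqrt (pos2 e he u).ne')).log (hpos u).ne'
    refine h2.congr_deriv ?_
    have := hpos u
    simp only [Pi.add_apply]
    set w := √(e + sin u ^ 2)
    clear_value w
    field_simp
    ring
  rw [intervalIntegral.integral_eq_sub_of_hasDerivAt (fun u _ => hd u)
    (Continuous.intervalIntegrable (Continuous.div (by fun_prop) (by fun_prop)
      fun u => (sqrt_pos.2 (pos2 e he u)).ne') _ _)]
  simp [log_sqrt he.le]

lemma tan_int : ∫ u in (0:ℝ)..(π/2), sin u / (1 + cos u) = log 2 := by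
  have hp : ∀ u ∈ Set.uIcc (0:ℝ) (π/2), 0 < 1 + cos u := by
    intro u hu
    rw [Set.uIcc_of_le (by positivity)] at hu
    have := cos_nonneg_of_neg_pi_div_two_le_of_le (by linarith [hu.1, pi_pos]) hu.2
    linarith
  have hd : ∀ u ∈ Set.uIcc (0:ℝ) (π/2), HasDerivAt (fun u => - log (1 + cos u))
      (sin u / (1 + cos u)) u := by
    intro u hu
    have := (((hasDerivAt_cos u).const_add 1).log (hp u hu).ne').neg
    refine this.congr_deriv ?_
    ring
  rw [intervalIntegral.integral_eq_sub_of_hasDerivAt hd]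
  · simp; norm_num
  · apply ContinuousOn.intervalIntegrable
    exact ContinuousOn.div (by fun_prop) (by fun_prop) fun u hu => (hp u hu).ne'

lemma R_lim : Tendsto (fun e => ∫ u in (0:ℝ)..(π/2), (1 - cos u) / √(e + sin u ^ 2))
    (𝓝[>] 0) (𝓝 (log 2)) := by
  rw [← tan_int]
  have hp : ∀ u ∈ Set.uIoc (0:ℝ) (π/2), 0 < sin u ∧ 0 ≤ cos u := by
    intro u hu
    rw [Set.uIoc_of_le (by positivity)] at hu
    exact ⟨sin_pos_of_pos_of_lt_pi hu.1 (by linarith [hu.2, pi_pos]),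
      cos_nonneg_of_neg_pi_div_two_le_of_le (by linarith [hu.1, pi_pos]) hu.2⟩
  apply intervalIntegral.tendsto_integral_filter_of_dominated_convergence (fun _ => (1:ℝ))
  · filter_upwards [self_mem_nhdsWithin] with e he
    exact (Continuous.div (by fun_prop) (by fun_prop)
      fun u => (sqrt_pos.2 (pos2 e he u)).ne').aestronglyMeasurable
  · filter_upwards [self_mem_nhdsWithin] with e he
    refine Eventually.of_forall fun u hu => ?_
    obtain ⟨h1, h2⟩ := hp u hu
    have h3 := sqrt_pos.2 (pos2 e he u)
    rw [norm_of_nonneg (div_nonneg (by linarith [cos_le_one u]) h3.le), div_le_one h3]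
    have h4 : sin u ≤ √(e + sin u ^ 2) := by
      apply le_sqrt_of_sq_le
      linarith [show (0:ℝ) < e from he]
    refine le_trans ?_ h4
    nlinarith [sin_sq_add_cos_sq u, cos_le_one u]
  · simp
  · refine Eventually.of_forall fun u hu => ?_
    obtain ⟨h1, h2⟩ := hp u hu
    have h5 : sin u / (1 + cos u) = (1 - cos u) / √(0 + sin u ^ 2) := by
      rw [zero_add, sqrt_sq h1.le, div_eq_div_iff (by positivity) h1.ne']
      nlinarith [sin_sq_add_cos_sq u]
    rw [h5]
    refine Tendsto.mono_left (ContinuousAt.tendsto ?_) nhdsWithin_le_nhds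
    refine ContinuousAt.div (by fun_prop) (by fun_prop) ?_
    rw [zero_add, sqrt_sq h1.le]; exact h1.ne'

lemma PP_lim : Tendsto (fun e => PP e + log e / 2) (𝓝[>] 0) (𝓝 (2 * log 2)) := by
  have h1 : Tendsto (fun e : ℝ => log (1 + √(e + 1))) (𝓝[>] 0) (𝓝 (log 2)) := by
    have : ContinuousAt (fun e : ℝ => log (1 + √(e + 1))) 0 := by
      apply ContinuousAt.log (by fun_prop)
      positivity
    have := this.tendsto.mono_left (nhdsWithin_le_nhds (s := Set.Ioi (0:ℝ)))
    simp only [zero_add, sqrt_one] at this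
    rwa [one_add_one_eq_two] at this
  have := h1.add R_lim
  rw [← two_mul] at this
  refine this.congr' ?_
  filter_upwards [self_mem_nhdsWithin] with e he
  have hc := cos_int e he
  have hne := fun u => (sqrt_pos.2 (pos2 e he u)).ne'
  have : PP e = (∫ u in (0:ℝ)..(π/2), cos u / √(e + sin u ^ 2))
      + ∫ u in (0:ℝ)..(π/2), (1 - cos u) / √(e + sin u ^ 2) := by
    rw [PP, ← intervalIntegral.integral_add]
    · congr 1; ext u; ring
    · exact (Continuous.div (by fun_prop) (by fun_prop) hne).intervalIntegrable _ _
    · exact (Continuous.div (by fun_prop) (by fun_prop) hne).intervalIntegrable _ _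
  rw [this, hc]; ring

lemma idlim : Tendsto (fun e : ℝ => e) (𝓝[>] 0) (𝓝 0) := nhdsWithin_le_nhds

lemma Pb_lim : Tendsto (fun e => PP e * bb e) (𝓝[>] 0) (𝓝 0) := by
  have hn : ContDiffOn ℝ (⊤ : ℕ∞) (fun e => ∫ u in (0:ℝ)..(π/2), cos u ^ 2 / √(1 + e * sin u ^ 2))
      (Set.Ioo (-1) 1) := by
    apply param_smooth _ isOpen_Ioo
    apply ContDiffOn.div (by fun_prop) sm_base
    rintro ⟨e, u⟩ ⟨he, -⟩; exact (sqrt_pos.2 (pos1 e he u)).ne'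
  have h1 := lim_of_smooth _ hn
  have h2 := ((idlim.mul PP_lim).sub (elog.div_const 2)).mul h1
  simp only [zero_mul, zero_div, sub_zero] at h2
  refine h2.congr' ?_
  filter_upwards [Ioo_mem_nhdsGT (zero_lt_one' ℝ)] with e he
  rw [bb_eq e ⟨by linarith [he.1], he.2⟩]
  ring

lemma wronskian (e : ℝ) (he : e ∈ Set.Ioo (0:ℝ) 1) : PP e * bb e - QQ e * pp e = -(π/2) := by
  refine const_lim (fun e => PP e * bb e - QQ e * pp e) _ ?_ ?_ e he
  · intro x hx
    have hx' : x ∈ Set.Ioo (-1:ℝ) 1 := ⟨by linarith [hx.1], hx.2⟩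
    have hx0 := hx.1.ne'
    have := ((PP_deriv x hx.1).mul (bb_deriv x hx' hx0)).sub
      ((QQ_deriv x hx.1).mul (pp_deriv' x hx' hx0))
    refine this.congr_deriv ?_
    ring
  · have := Pb_lim.sub (QQ_lim.mul (lim_of_smooth _ pp_smooth))
    rw [pp_zero] at this
    simpa using this

noncomputable def kap (e : ℝ) : ℝ :=
  (2 * mm e * (π + 2 * pp e) - 4 * pp e ^ 2) / (4 * π * (1 + e) * pp e ^ 2)

lemma kap_smooth : ContDiffOn ℝ (⊤ : ℕ∞) kap (Set.Ioo (-1) 1) := by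
  have h1 := pp_smooth
  have h2 := mm_smooth
  apply ContDiffOn.div
  · exact ((contDiffOn_const.mul h2).mul (contDiffOn_const.add (contDiffOn_const.mul h1))).sub
      (contDiffOn_const.mul (h1.pow 2))
  · exact (contDiffOn_const.mul (contDiffOn_const.add contDiffOn_id)).mul (h1.pow 2)
  · intro e he
    have := pp_pos e he
    have : 0 < 1 + e := by linarith [he.1]
    positivity

noncomputable def kk (e : ℝ) : ℝ := ∫ x in (0:ℝ)..e, kap x

lemma kk_deriv (e : ℝ) (he : e ∈ Set.Ioo (-1:ℝ) 1) : HasDerivAt kk (kap e) e := by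
  have hc := kap_smooth.continuousOn
  have hsub : Set.uIcc 0 e ⊆ Set.Ioo (-1:ℝ) 1 :=
    Set.ordConnected_Ioo.uIcc_subset (by norm_num) he
  apply intervalIntegral.integral_hasDerivAt_right
  · exact (hc.mono hsub).intervalIntegrable
  · exact hc.stronglyMeasurableAtFilter isOpen_Ioo _ he
  · exact hc.continuousAt (isOpen_Ioo.mem_nhds he)

lemma kk_smooth : ContDiffOn ℝ (⊤ : ℕ∞) kk (Set.Ioo (-1) 1) := by
  rw [contDiffOn_infty_iff_deriv_of_isOpen isOpen_Ioo]
  exact ⟨fun x hx => (kk_deriv x hx).differentiableAt.differentiableWithinAt,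
    kap_smooth.congr fun x hx => (kk_deriv x hx).deriv⟩

lemma kk_zero : kk 0 = 0 := by simp [kk]

lemma PP_eq (e : ℝ) (he : e ∈ Set.Ioo (0:ℝ) 1) :
    PP e / pp e + log e / π + kk e = 4 * log 2 / π := by
  refine const_lim (fun e => PP e / pp e + log e / π + kk e) _ ?_ ?_ e he
  · intro x hx
    have hx' : x ∈ Set.Ioo (-1:ℝ) 1 := ⟨by linarith [hx.1], hx.2⟩
    have hx0 := hx.1
    have hp := pp_pos x hx'
    have := (((PP_deriv x hx.1).div (pp_deriv' x hx' hx0.ne') hp.ne').add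
      ((hasDerivAt_log hx0.ne').div_const π)).add (kk_deriv x hx')
    refine this.congr_deriv ?_
    have hw := wronskian x hx
    have hm := mm_eq x hx'
    have h1 : 0 < 1 + x := by linarith
    have hQ : QQ x = (PP x * bb x + π / 2) / pp x := by
      rw [eq_div_iff hp.ne']; linarith
    have hm' : mm x = (π / 2 - pp x) / x := by
      rw [eq_div_iff hx0.ne']; linarith
    rw [kap, hQ, hm']
    field_simp
    ring
  · have hq := lim_of_smooth _ pp_smooth
    have hm := lim_of_smooth _ mm_smooth
    have hk := lim_of_smooth _ kk_smooth
    rw [pp_zero] at hq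
    rw [kk_zero] at hk
    have h := ((PP_lim.div hq (by positivity)).sub
      ((elog.mul hm).div (hq.const_mul π) (by positivity))).add hk
    have hc : 2 * log 2 / (π / 2) - 0 * mm 0 / (π * (π / 2)) + 0 = 4 * log 2 / π := by
      field_simp; ring
    rw [hc] at h
    refine h.congr' ?_
    filter_upwards [Ioo_mem_nhdsGT (zero_lt_one' ℝ)] with x hx
    have hx' : x ∈ Set.Ioo (-1:ℝ) 1 := ⟨by linarith [hx.1], hx.2⟩
    have hp := pp_pos x hx'
    have hx0 := hx.1
    have hm' : mm x = (π / 2 - pp x) / x := by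
      rw [eq_div_iff hx0.ne', mm_eq x hx']; ring
    simp only [Pi.div_apply, hm']
    field_simp
    ring

lemma F_eq (e : ℝ) (he : 0 < e) : ringKernelF (4 * e) = (1 + 2 * e) * PP e - 2 * QQ e := by
  have hne := fun u => (sqrt_pos.2 (pos2 e he u)).ne'
  have h := intervalIntegral.integral_comp_mul_left (a := 0) (b := π/2)
    (fun t => cos t / √(2 * (1 - cos t) + 4 * e)) (two_ne_zero' ℝ)
  rw [mul_zero, mul_div_cancel₀ _ (two_ne_zero' ℝ)] at h
  have h' : ringKernelF (4 * e) = 2 * ∫ x in (0:ℝ)..(π/2),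
      cos (2 * x) / √(2 * (1 - cos (2 * x)) + 4 * e) := by
    rw [h, ringKernelF, smul_eq_mul]; ring
  rw [h', PP, QQ, ← intervalIntegral.integral_const_mul, ← intervalIntegral.integral_const_mul,
    ← intervalIntegral.integral_const_mul, ← intervalIntegral.integral_sub]
  · congr 1; ext u
    have h1 : 2 * (1 - cos (2 * u)) + 4 * e = 2 ^ 2 * (e + sin u ^ 2) := by
      rw [cos_two_mul, cos_sq']; ring
    have h2 : cos (2 * u) = 1 + 2 * e - 2 * √(e + sin u ^ 2) ^ 2 := by
      rw [sq_sqrt (pos2 e he u).le, cos_two_mul, cos_sq']; ring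
    rw [h1, sqrt_mul (by positivity), sqrt_sq (by norm_num), h2]
    have := hne u
    field_simp
  · exact (Continuous.const_mul (continuous_const.div (by fun_prop) hne) _).intervalIntegrable _ _
  · apply Continuous.intervalIntegrable; fun_prop

noncomputable def LL (e : ℝ) : ℝ := pp e * (1 + 2 * e) - 2 * bb e

lemma LL_smooth : ContDiffOn ℝ (⊤ : ℕ∞) LL (Set.Ioo (-1) 1) :=
  (pp_smooth.mul (contDiffOn_const.add (contDiffOn_const.mul contDiffOn_id))).sub
    (contDiffOn_const.mul bb_smooth)

lemma LL_zero : LL 0 = π / 2 := by simp [LL, pp_zero, bb_zero]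

/-- Expansion of `F` near `s = 0`:
`F(s) = log(8/√s) − 2 + f₁(s) + f₂(s) log s` with `f₁, f₂` smooth near `0` and
vanishing at `0`. -/
theorem ringKernelF_expansion :
    ∃ δ > (0:ℝ), ∃ f₁ f₂ : ℝ → ℝ,
      ContDiffOn ℝ (⊤ : ℕ∞) f₁ (Set.Ioo (-δ) δ) ∧
      ContDiffOn ℝ (⊤ : ℕ∞) f₂ (Set.Ioo (-δ) δ) ∧
      f₁ 0 = 0 ∧ f₂ 0 = 0 ∧
      ∀ s ∈ Set.Ioo (0:ℝ) δ,
        ringKernelF s = Real.log (8 / Real.sqrt s) - 2 + f₁ s + f₂ s * Real.log s := by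
  have hmap : Set.MapsTo (fun s : ℝ => s / 4) (Set.Ioo (-4) 4) (Set.Ioo (-1) 1) := by
    intro s hs
    exact ⟨by simp only []; linarith [hs.1], by simp only []; linarith [hs.2]⟩
  have hdiv : ContDiffOn ℝ (⊤ : ℕ∞) (fun s : ℝ => s / 4) (Set.Ioo (-4) 4) := by fun_prop
  have hA : ContDiffOn ℝ (⊤ : ℕ∞) (fun e => LL e * (4 * log 2 / π - kk e + 2 * log 2 / π)
      - π / pp e - 3 * log 2 + 2) (Set.Ioo (-1) 1) := by
    refine (((LL_smooth.mul ((contDiffOn_const.sub kk_smooth).add contDiffOn_const)).sub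
      (contDiffOn_const.div pp_smooth fun e he => (pp_pos e he).ne')).sub contDiffOn_const).add
      contDiffOn_const
  have hB : ContDiffOn ℝ (⊤ : ℕ∞) (fun e => 1 / 2 - LL e / π) (Set.Ioo (-1) 1) :=
    contDiffOn_const.sub (LL_smooth.div_const π)
  refine ⟨4, by norm_num, _, _, hA.comp hdiv hmap, hB.comp hdiv hmap, ?_, ?_, ?_⟩
  · simp only [Function.comp_apply, zero_div, LL_zero, kk_zero, pp_zero]
    field_simp
    ring
  · simp only [Function.comp_apply, zero_div, LL_zero]
    field_simp
    ring
  · intro s hs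
    obtain ⟨e, rfl⟩ : ∃ e, s = 4 * e := ⟨s / 4, by ring⟩
    have he : e ∈ Set.Ioo (0:ℝ) 1 := ⟨by linarith [hs.1], by linarith [hs.2]⟩
    have he0 := he.1
    have hp := pp_pos e ⟨by linarith [he.1], he.2⟩
    have hl4 : log 4 = 2 * log 2 := by
      rw [show (4:ℝ) = 2 ^ 2 by norm_num, log_pow]; norm_num
    have hl8 : log 8 = 3 * log 2 := by
      rw [show (8:ℝ) = 2 ^ 3 by norm_num, log_pow]; norm_num
    have hls : log (4 * e) = 2 * log 2 + log e := by
      rw [log_mul (by norm_num) he0.ne', hl4]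
    rw [F_eq e he0, log_div (by norm_num) (sqrt_pos.2 hs.1).ne', log_sqrt hs.1.le, hls, hl8]
    simp only [Function.comp_apply, mul_div_cancel_left₀ e (four_ne_zero' ℝ)]
    have hw := wronskian e he
    have hQ : QQ e = (PP e * bb e + π / 2) / pp e := by
      rw [eq_div_iff hp.ne']; linarith
    have hP : PP e = pp e * (4 * log 2 / π - log e / π - kk e) := by
      rw [← PP_eq e he]; field_simp; ring
    rw [hQ, hP, LL]
    field_simp
    ring
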